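/- Let k ≥ 2, let c be an admissible sequence with c_1 = 1, and let F = (V_0,…,V_{k−1}) be an isotropic partial flag of length k−1 whose completion (V̄_0,…,V̄_{2k−1}) satisfies e(V̄_p) ⊆ V̄_{c_p} for all p = 0,…,2k−1. Let j ∈ ℤ be such that V_1 ∩ E_j ≠ 0 while V_1 ∩ E_{j′} = 0 for every integer j′ > j. Then there exists ℓ ∈ {1,…,r} such that j = μ_ℓ − 1, μ_ℓ ≥ 2, and v_{μ_ℓ−1}^ℓ ∈ V_1. -/

import Mathlib

open Module Submodule

noncomputable section

/-- The orthogonal `W^⊥ = {v : ω(v,w) = 0 for all w ∈ W}` of a subspace with respect to a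
bilinear form `ω`. -/
def ortho {V : Type*} [AddCommGroup V] [Module ℂ V]
    (ω : V →ₗ[ℂ] V →ₗ[ℂ] ℂ) (W : Submodule ℂ V) : Submodule ℂ V where
  carrier := {v | ∀ w ∈ W, ω v w = 0}
  zero_mem' := by intro w _; simp
  add_mem' := by
    intro a b ha hb w hw
    rw [map_add, LinearMap.add_apply, ha w hw, hb w hw, add_zero]
  smul_mem' := by
    intro t a ha w hw
    rw [map_smul, LinearMap.smul_apply, ha w hw, smul_zero]

/-- The completion `(V̄_0, …, V̄_{2k−1})` of an isotropic partial flag `(V_0, …, V_{k−1})`: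
`V̄_p = V_p` for `p ≤ k−1` and `V̄_p = (V_{2k−1−p})^⊥` for `k ≤ p ≤ 2k−1`. -/
def completion {V : Type*} [AddCommGroup V] [Module ℂ V]
    (ω : V →ₗ[ℂ] V →ₗ[ℂ] ℂ) {k : ℕ} (W : Fin k → Submodule ℂ V) :
    ℕ → Submodule ℂ V := fun p =>
  if h : p < k then W ⟨p, h⟩
  else if h2 : 2 * k - 1 - p < k then ortho ω (W ⟨2 * k - 1 - p, h2⟩) else ⊥

/-- `inBlock m i` says that `i` belongs to the index set
`I = {−m+1, −m+3, …, m−3, m−1} ⊆ ℤ` attached to a Jordan block of size `m`. -/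
def inBlock (m : ℕ) (i : ℤ) : Prop :=
  1 - (m : ℤ) ≤ i ∧ i ≤ (m : ℤ) - 1 ∧ (2 : ℤ) ∣ (i - ((m : ℤ) - 1))

/-- The weight space `E_j`: the span of the vectors `v_j^ℓ` over all `ℓ` with `j ∈ I_ℓ`. -/
def wtSpace {V : Type*} [AddCommGroup V] [Module ℂ V] {r : ℕ}
    (μ : Fin r → ℕ) (v : Fin r → ℤ → V) (j : ℤ) : Submodule ℂ V :=
  Submodule.span ℂ {x | ∃ ℓ : Fin r, inBlock (μ ℓ) j ∧ x = v ℓ j}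

/-- With the Jordan basis data `v_i^ℓ` for the nilpotent skew-adjoint
`e`, let `c` be admissible with `c₁ = 1` and `F` an isotropic partial flag whose completion
satisfies `e(V̄_p) ⊆ V̄_{c_p}`. If `j` is maximal with `V₁ ∩ E_j ≠ 0`, then `j = μ_ℓ − 1`
for some `ℓ` with `μ_ℓ ≥ 2`, and `v_{μ_ℓ−1}^ℓ ∈ V₁`. -/
theorem stmt_18 (V : Type*) [AddCommGroup V] [Module ℂ V] [FiniteDimensional ℂ V]
    (ω : V →ₗ[ℂ] V →ₗ[ℂ] ℂ)
    (hnd : ∀ x, (∀ w, ω x w = 0) → x = 0)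
    (hso : (∀ x w, ω x w = ω w x) ∨ (∀ x, ω x x = 0))
    (e : Module.End ℂ V) (hnil : IsNilpotent e)
    (hskew : ∀ x w, ω (e x) w = - ω x (e w))
    (r : ℕ) (μ : Fin r → ℕ) (hμpos : ∀ ℓ, 1 ≤ μ ℓ)
    (hμanti : ∀ ℓ q : Fin r, ℓ < q → μ q < μ ℓ)
    (v : Fin r → ℤ → V)
    (hbasis : ∃ b : Basis {p : Fin r × ℤ // inBlock (μ p.1) p.2} ℂ V,
      ∀ p, b p = v p.1.1 p.1.2)
    (he1 : ∀ (ℓ : Fin r) (i : ℤ), inBlock (μ ℓ) i → inBlock (μ ℓ) (i + 2) →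
      e (v ℓ i) = v ℓ (i + 2))
    (he2 : ∀ ℓ : Fin r, e (v ℓ ((μ ℓ : ℤ) - 1)) = 0)
    (hω : ∀ (ℓ q : Fin r) (i j : ℤ), inBlock (μ ℓ) i → inBlock (μ q) j →
      (ω (v ℓ i) (v q j) ≠ 0 ↔ ℓ = q ∧ i + j = 0))
    (k : ℕ) (hk : 2 ≤ k)
    (c : ℕ → ℕ) (hcmono : ∀ p q, p ≤ q → q < 2 * k → c p ≤ c q)
    (hcle : ∀ p < 2 * k, c p ≤ p) (hc1 : c 1 = 1)
    (F : Fin k → Submodule ℂ V) (hF0 : F ⟨0, by omega⟩ = ⊥) (hFmono : Monotone F)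
    (hFiso : ∀ p, ∀ a ∈ F p, ∀ b ∈ F p, ω a b = 0)
    (hFcomp : ∀ p < 2 * k, (completion ω F p).map e ≤ completion ω F (c p))
    (j : ℤ)
    (hj1 : F ⟨1, by omega⟩ ⊓ wtSpace μ v j ≠ ⊥)
    (hj2 : ∀ j' : ℤ, j < j' → F ⟨1, by omega⟩ ⊓ wtSpace μ v j' = ⊥) :
    ∃ ℓ : Fin r, j = (μ ℓ : ℤ) - 1 ∧ 2 ≤ μ ℓ ∧
      v ℓ ((μ ℓ : ℤ) - 1) ∈ F ⟨1, by omega⟩ := by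
  have hF1 : ∀ x ∈ F ⟨1, by omega⟩, e x ∈ F ⟨1, by omega⟩ := by
    intro x hx
    have h := hFcomp 1 (by omega)
    have hc : completion ω F 1 = F ⟨1, by omega⟩ := by
      unfold completion
      rw [dif_pos (show 1 < k by omega)]
    rw [hc1, hc] at h
    exact h (Submodule.mem_map_of_mem hx)
  obtain ⟨x, hx, hx0⟩ := (Submodule.ne_bot_iff _).1 hj1
  obtain ⟨hxF, hxE⟩ := Submodule.mem_inf.1 hx
  have htop : ∀ q, inBlock (μ q) j → ¬ inBlock (μ q) (j + 2) → j = (μ q : ℤ) - 1 := by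
    intro q h1 h2
    unfold inBlock at h1 h2
    omega
  have hexE : e x ∈ wtSpace μ v (j + 2) := by
    have hle : wtSpace μ v j ≤ (wtSpace μ v (j + 2)).comap e := by
      conv_lhs => unfold wtSpace
      rw [Submodule.span_le]
      rintro y ⟨q, hq, rfl⟩
      change e (v q j) ∈ wtSpace μ v (j + 2)
      by_cases h : inBlock (μ q) (j + 2)
      · rw [he1 q j hq h]
        exact Submodule.subset_span ⟨q, h, rfl⟩
      · have h0 : e (v q j) = 0 := by rw [htop q hq h]; exact he2 q
        rw [h0]
        exact Submodule.zero_mem _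
    exact hle hxE
  have hex : e x = 0 := by
    have : e x ∈ F ⟨1, by omega⟩ ⊓ wtSpace μ v (j + 2) := ⟨hF1 x hxF, hexE⟩
    rw [hj2 (j + 2) (by omega)] at this
    simpa using this
  obtain ⟨b, hb⟩ := hbasis
  have hzero : ∀ y : V, (∀ q i, inBlock (μ q) i → ω y (v q i) = 0) → y = 0 := by
    intro y hy
    apply hnd
    intro w
    have : ω y = 0 := by
      apply b.ext
      intro p
      rw [hb p]
      simpa using hy _ _ p.2
    simp [this]
  have hωz : ∀ q i, inBlock (μ q) i → i + j ≠ 0 → ω x (v q i) = 0 := by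
    intro q i hqi hij
    have hle : wtSpace μ v j ≤ LinearMap.ker (ω.flip (v q i)) := by
      unfold wtSpace
      rw [Submodule.span_le]
      rintro y ⟨l, hl, rfl⟩
      by_contra hne
      have := (hω l q j i hl hqi).1 (by simpa using hne)
      omega
    simpa using hle hxE
  have hωz2 : ∀ q i, inBlock (μ q) i → j ≠ (μ q : ℤ) - 1 → ω x (v q i) = 0 := by
    intro q i hqi hjq
    by_cases hij : i + j = 0
    · have h2 : inBlock (μ q) (i - 2) := by
        unfold inBlock at hqi ⊢
        omega
      have h3 := he1 q (i - 2) h2 (by simpa using hqi)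
      have h4 := hskew x (v q (i - 2))
      rw [h3, hex, sub_add_cancel] at h4
      simpa using h4.symm
    · exact hωz q i hqi hij
  have hex' : ∃ l : Fin r, j = (μ l : ℤ) - 1 := by
    by_contra hcon
    push Not at hcon
    exact hx0 (hzero x fun q i h => hωz2 q i h (hcon q))
  obtain ⟨l, hl⟩ := hex'
  have hpos := hμpos l
  have hbj : inBlock (μ l) j := by
    unfold inBlock; omega
  have hbj' : inBlock (μ l) (-j) := by
    unfold inBlock; omega
  have hne : ω (v l j) (v l (-j)) ≠ 0 := (hω l l j (-j) hbj hbj').2 ⟨rfl, by omega⟩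
  have hμinj : ∀ q, j = (μ q : ℤ) - 1 → q = l := by
    intro q hq
    rcases lt_trichotomy q l with h | h | h
    · have := hμanti _ _ h; omega
    · exact h
    · have := hμanti _ _ h; omega
  have hxeq : x - (ω x (v l (-j)) / ω (v l j) (v l (-j))) • v l j = 0 := by
    apply hzero
    intro q i hqi
    by_cases h : q = l ∧ i + j = 0
    · obtain ⟨rfl, h2⟩ := h
      obtain rfl : i = -j := by omega
      simp [hne]
    · have h1 : ω x (v q i) = 0 := by
        by_cases hq : q = l
        · exact hωz q i hqi fun h' => h ⟨hq, h'⟩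
        · exact hωz2 q i hqi fun h' => hq (hμinj q h')
      have h2 : ω (v l j) (v q i) = 0 := by
        by_contra h3
        have h4 := (hω l q j i hbj hqi).1 h3
        exact h ⟨h4.1.symm, by omega⟩
      simp [h1, h2]
  have hmem : v l j ∈ F ⟨1, by omega⟩ := by
    have h1 := sub_eq_zero.1 hxeq
    have ht : ω x (v l (-j)) / ω (v l j) (v l (-j)) ≠ 0 := by
      intro h
      rw [h, zero_smul] at h1
      exact hx0 h1
    rw [h1] at hxF
    exact (Submodule.smul_mem_iff _ ht).1 hxF
  refine ⟨l, hl, ?_, hl ▸ hmem⟩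
  by_contra hlt
  have hj0 : j = 0 := by omega
  subst hj0
  exact hne (by simpa using hFiso _ _ hmem _ hmem)
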